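/- For every λ > 0, the differential entropy (in nats) of the non-central chi distribution with two degrees of freedom and non-centrality parameter λ, whose density is p_S(s) = s·e^{−(s²+λ)/2} I₀(s√λ) for s ≥ 0, satisfies −∫₀^∞ p_S(s) ln p_S(s) ds ≥ (1/2) ln(8π e) − ln 6 − (1/2) ∫_{λ/2}^∞ (e^{−t}/t) dt. -/

import Mathlib

open Real MeasureTheory intervalIntegral

/-- The zeroth-order modified Bessel function of the first kind,
`I₀(x) = (1/π) ∫₀^π e^{x cos θ} dθ`. -/
noncomputable def besselI0 (x : ℝ) : ℝ :=
  (1 / π) * ∫ θ in (0:ℝ)..π, Real.exp (x * Real.cos θ)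

/-- The density of the non-central chi distribution with two degrees of freedom and
non-centrality parameter `λ` (the distribution of `√T` with `T` non-central chi-square). -/
noncomputable def ncChiPdf (l s : ℝ) : ℝ :=
  s * Real.exp (-(s ^ 2 + l) / 2) * besselI0 (s * Real.sqrt l)

theorem besselI0_nonneg (x : ℝ) : 0 ≤ besselI0 x :=
  mul_nonneg (by positivity) (integral_nonneg pi_pos.le fun _ _ => (exp_pos _).le)

@[fun_prop]
theorem continuous_besselI0 : Continuous besselI0 := by
  unfold besselI0
  fun_prop

theorem pi_mul_besselI0 (x : ℝ) :
    π * besselI0 x = ∫ θ in (0 : ℝ)..π, exp (x * cos θ) := by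
  rw [besselI0]
  field_simp

theorem besselI0_neg (x : ℝ) : besselI0 (-x) = besselI0 x := by
  have h := integral_comp_sub_left (a := 0) (b := π) (fun θ => exp (x * cos θ)) π
  simp only [cos_pi_sub, sub_self, sub_zero] at h
  simp only [besselI0, ← h, neg_mul, mul_neg]

theorem sinh_mul_le_mul_sinh {c x : ℝ} (hc0 : 0 ≤ c) (hc1 : c ≤ 1) (hx : 0 ≤ x) :
    sinh (c * x) ≤ c * sinh x := by
  have hmono : MonotoneOn (fun x => c * sinh x - sinh (c * x)) (Set.Ici 0) := by
    refine monotoneOn_of_deriv_nonneg (convex_Ici 0) (by fun_prop) (by fun_prop) fun y hy => ?_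
    rw [interior_Ici] at hy
    have hd : HasDerivAt (fun x => c * sinh x - sinh (c * x))
        (c * cosh y - cosh (c * y) * (c * 1)) y :=
      ((hasDerivAt_sinh y).const_mul c).sub (((hasDerivAt_id y).const_mul c).sinh)
    rw [hd.deriv]
    have hy' : 0 < y := hy
    have : cosh (c * y) ≤ cosh y := by
      rw [cosh_le_cosh, abs_of_nonneg (by positivity), abs_of_pos hy']
      nlinarith
    nlinarith
  have h := hmono (Set.mem_Ici.2 le_rfl) (Set.mem_Ici.2 hx) hx
  simp only [sinh_zero, mul_zero, sub_zero] at h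
  linarith

theorem cosh_eq_one_add_two_mul_sinh_half_sq (x : ℝ) : cosh x = 1 + 2 * sinh (x / 2) ^ 2 := by
  have h := cosh_two_mul (x / 2)
  rw [mul_div_cancel₀ x two_ne_zero, cosh_sq] at h
  linarith

theorem cosh_mul_le {c : ℝ} (hc : |c| ≤ 1) (x : ℝ) :
    cosh (x * c) ≤ 1 + c ^ 2 * (cosh x - 1) := by
  have h := sinh_mul_le_mul_sinh (abs_nonneg c) hc (x := |x| / 2) (by positivity)
  have h0 : 0 ≤ sinh (|c| * (|x| / 2)) := sinh_nonneg_iff.2 (by positivity)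
  rw [← cosh_abs (x * c), ← cosh_abs x, cosh_eq_one_add_two_mul_sinh_half_sq |x * c|,
    cosh_eq_one_add_two_mul_sinh_half_sq |x|, abs_mul, ← sq_abs c,
    show |x| * |c| / 2 = |c| * (|x| / 2) by ring]
  nlinarith [pow_le_pow_left₀ h0 h 2]

theorem besselI0_le_exp_sq (x : ℝ) : besselI0 x ≤ exp (x ^ 2 / 4) := by
  have h1 : π * besselI0 x + π * besselI0 (-x) ≤ ∫ θ in (0 : ℝ)..π,
      (2 + 2 * (cosh x - 1) * cos θ ^ 2) := by
    rw [pi_mul_besselI0, pi_mul_besselI0, ← integral_add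
      (Continuous.intervalIntegrable (by fun_prop) _ _)
      (Continuous.intervalIntegrable (by fun_prop) _ _)]
    refine integral_mono pi_pos.le (Continuous.intervalIntegrable (by fun_prop) _ _)
      (Continuous.intervalIntegrable (by fun_prop) _ _) fun θ => ?_
    have h := cosh_mul_le (abs_cos_le_one θ) x
    rw [cosh_eq] at h
    simp only [neg_mul]
    linarith
  rw [integral_add (by simp) (Continuous.intervalIntegrable (by fun_prop) _ _),
    intervalIntegral.integral_const_mul, integral_cos_sq, besselI0_neg] at h1
  simp only [intervalIntegral.integral_const, sin_pi, sin_zero, smul_eq_mul] at h1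
  have h2 : besselI0 x ≤ (1 + cosh x) / 2 := by
    refine le_of_mul_le_mul_left ?_ pi_pos
    linarith
  have h3 : (1 + cosh x) / 2 = cosh (x / 2) ^ 2 := by
    rw [cosh_eq_one_add_two_mul_sinh_half_sq, cosh_sq]
    ring
  calc besselI0 x ≤ cosh (x / 2) ^ 2 := h3 ▸ h2
    _ ≤ exp ((x / 2) ^ 2 / 2) ^ 2 := by
      gcongr
      exact cosh_le_exp_half_sq _
    _ = exp (x ^ 2 / 4) := by rw [← exp_nat_mul]; ring_nf

theorem besselI0_le_exp {x : ℝ} (hx : 0 ≤ x) : besselI0 x ≤ exp x := by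
  refine le_of_mul_le_mul_left ?_ pi_pos
  rw [pi_mul_besselI0]
  calc ∫ θ in (0 : ℝ)..π, exp (x * cos θ) ≤ ∫ _ in (0 : ℝ)..π, exp x := by
        refine integral_mono pi_pos.le (Continuous.intervalIntegrable (by fun_prop) _ _)
          (by simp) fun θ => exp_le_exp.2 ?_
        nlinarith [cos_le_one θ]
    _ = π * exp x := by simp

theorem besselI0_sq_le {x : ℝ} (hx : 0 < x) :
    besselI0 x ^ 2 ≤ exp (2 * x) * (π / (8 * x)) := by
  have hb : 0 < 2 * x / π ^ 2 := by positivity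
  have h1 : π * besselI0 x ≤ exp x * (√(π / (2 * x / π ^ 2)) / 2) := by
    rw [pi_mul_besselI0, ← integral_gaussian_Ioi, integral_of_le pi_pos.le,
      ← MeasureTheory.integral_const_mul]
    calc ∫ θ in Set.Ioc 0 π, exp (x * cos θ)
        ≤ ∫ θ in Set.Ioc 0 π, exp x * exp (-(2 * x / π ^ 2) * θ ^ 2) := by
          refine setIntegral_mono_on
            (Continuous.integrableOn_Ioc (by fun_prop)) (Continuous.integrableOn_Ioc (by fun_prop))
            measurableSet_Ioc fun θ hθ => ?_
          rw [← exp_add, exp_le_exp]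
          have h := cos_le_one_sub_mul_cos_sq (x := θ) (by rw [abs_of_pos hθ.1]; exact hθ.2)
          calc x * cos θ ≤ x * (1 - 2 / π ^ 2 * θ ^ 2) := by gcongr
            _ = _ := by ring
      _ ≤ ∫ θ in Set.Ioi 0, exp x * exp (-(2 * x / π ^ 2) * θ ^ 2) :=
          setIntegral_mono_set ((integrable_exp_neg_mul_sq hb).const_mul _).integrableOn
            (Filter.Eventually.of_forall fun _ => by positivity)
            (Filter.Eventually.of_forall Set.Ioc_subset_Ioi_self)
  have h2 := pow_le_pow_left₀ (mul_nonneg pi_pos.le (besselI0_nonneg x)) h1 2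
  rw [mul_pow, mul_pow, div_pow, sq_sqrt (by positivity), ← exp_nat_mul] at h2
  refine le_of_mul_le_mul_left (h2.trans_eq ?_) (show 0 < π ^ 2 by positivity)
  push_cast
  field_simp
  norm_num

theorem ncChiPdf_nonneg (l : ℝ) {s : ℝ} (hs : 0 ≤ s) : 0 ≤ ncChiPdf l s :=
  mul_nonneg (mul_nonneg hs (exp_pos _).le) (besselI0_nonneg _)

@[fun_prop]
theorem continuous_ncChiPdf (l : ℝ) : Continuous (ncChiPdf l) := by
  unfold ncChiPdf
  fun_prop

theorem ncChiPdf_sq_le_of_one_le {l s : ℝ} (hl : 1 ≤ l) (hs : 0 < s) :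
    ncChiPdf l s ^ 2 ≤ 9 / (2 * π * exp 1) := by
  have hl0 : 0 ≤ l := by linarith
  obtain ⟨a, ha1, rfl⟩ : ∃ a, 1 ≤ a ∧ l = a ^ 2 := ⟨√l, one_le_sqrt.2 hl, (sq_sqrt hl0).symm⟩
  have ha : 0 < a := by linarith
  have hratio : s / a ≤ exp ((s - a) / a) := by
    have h := add_one_le_exp ((s - a) / a)
    rwa [sub_div, div_self ha.ne', sub_add_cancel, ← div_self ha.ne', ← sub_div] at h
  have hquad : (s - a) / a - (s - a) ^ 2 ≤ 1 / 4 := by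
    have hinv : a⁻¹ ≤ 1 := inv_le_one_of_one_le₀ ha1
    have hinv0 : 0 ≤ a⁻¹ := by positivity
    rw [div_eq_mul_inv]
    nlinarith [sq_nonneg (s - a - a⁻¹ / 2)]
  have hexp : π ^ 2 * exp (1 / 4) * exp 1 ≤ 36 := by
    have hpi : π ^ 2 ≤ 3.15 ^ 2 := by gcongr; exact pi_lt_d2.le
    have h1 : exp 1 ≤ 2.72 := exp_one_lt_d9.le.trans (by norm_num)
    have h2 : exp (1 / 4) ≤ 1.33 := by
      refine le_of_pow_le_pow_left₀ four_ne_zero (by norm_num) ?_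
      rw [← exp_nat_mul]
      norm_num
      linarith
    calc π ^ 2 * exp (1 / 4) * exp 1 ≤ 3.15 ^ 2 * 1.33 * 2.72 := by gcongr
      _ ≤ 36 := by norm_num
  calc ncChiPdf (a ^ 2) s ^ 2
      = s ^ 2 * exp (-(s ^ 2 + a ^ 2)) * besselI0 (s * a) ^ 2 := by
        rw [ncChiPdf, sqrt_sq ha.le, mul_pow, mul_pow, ← exp_nat_mul]
        ring_nf
    _ ≤ s ^ 2 * exp (-(s ^ 2 + a ^ 2)) * (exp (2 * (s * a)) * (π / (8 * (s * a)))) := by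
        gcongr
        exact besselI0_sq_le (by positivity)
    _ = π / 8 * (s / a) * exp (-(s - a) ^ 2) := by
        rw [show -(s - a) ^ 2 = -(s ^ 2 + a ^ 2) + 2 * (s * a) by ring, exp_add]
        field_simp
    _ ≤ π / 8 * exp ((s - a) / a) * exp (-(s - a) ^ 2) := by gcongr
    _ = π / 8 * exp ((s - a) / a - (s - a) ^ 2) := by
        rw [sub_eq_add_neg _ ((s - a) ^ 2), exp_add]
        ring
    _ ≤ π / 8 * exp (1 / 4) := by gcongr
    _ ≤ 9 / (2 * π * exp 1) := by
        rw [le_div_iff₀ (by positivity)]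
        linarith

theorem ncChiPdf_sq_le_of_le_one {l s : ℝ} (hl0 : 0 ≤ l) (hl : l ≤ 1) :
    ncChiPdf l s ^ 2 ≤ 9 / (2 * π * exp 1) := by
  have hexp : s ^ 2 * exp (-s ^ 2 + l * (s ^ 2 - 2) / 2) ≤ exp (-1) := by
    rcases le_total (s ^ 2) 2 with h | h
    · have h1 : s ^ 2 ≤ exp (s ^ 2 - 1) := by linarith [add_one_le_exp (s ^ 2 - 1)]
      calc s ^ 2 * exp (-s ^ 2 + l * (s ^ 2 - 2) / 2)
          ≤ exp (s ^ 2 - 1) * exp (-s ^ 2 + l * (s ^ 2 - 2) / 2) := by gcongr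
        _ = exp (-1 + l * (s ^ 2 - 2) / 2) := by rw [← exp_add]; ring_nf
        _ ≤ exp (-1) := exp_le_exp.2 (by nlinarith)
    · have h1 : s ^ 2 / 2 ≤ exp (s ^ 2 / 2 - 1) := by linarith [add_one_le_exp (s ^ 2 / 2 - 1)]
      have h2 : 2 ≤ exp 1 := by linarith [add_one_le_exp (1 : ℝ)]
      calc s ^ 2 * exp (-s ^ 2 + l * (s ^ 2 - 2) / 2)
          = 2 * (s ^ 2 / 2) * exp (-s ^ 2 + l * (s ^ 2 - 2) / 2) := by ring
        _ ≤ exp 1 * exp (s ^ 2 / 2 - 1) * exp (-s ^ 2 + l * (s ^ 2 - 2) / 2) := by gcongr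
        _ = exp (-s ^ 2 / 2 + l * (s ^ 2 - 2) / 2) := by rw [← exp_add, ← exp_add]; ring_nf
        _ ≤ exp (-1) := exp_le_exp.2 (by nlinarith)
  calc ncChiPdf l s ^ 2
      = s ^ 2 * exp (-(s ^ 2 + l)) * besselI0 (s * √l) ^ 2 := by
        rw [ncChiPdf, mul_pow, mul_pow, ← exp_nat_mul]
        ring_nf
    _ ≤ s ^ 2 * exp (-(s ^ 2 + l)) * exp ((s * √l) ^ 2 / 4) ^ 2 := by
        gcongr
        · exact besselI0_nonneg _
        · exact besselI0_le_exp_sq _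
    _ = s ^ 2 * exp (-s ^ 2 + l * (s ^ 2 - 2) / 2) := by
        rw [← exp_nat_mul, mul_pow, sq_sqrt hl0, mul_assoc, ← exp_add]
        push_cast
        ring_nf
    _ ≤ exp (-1) := hexp
    _ ≤ 9 / (2 * π * exp 1) := by
        rw [exp_neg, le_div_iff₀ (by positivity)]
        field_simp
        linarith [pi_lt_four]

/-- The density never exceeds `3 / √(2πe)`, stated for its logarithm. -/
theorem log_ncChiPdf_le {l s : ℝ} (hl : 0 ≤ l) (hs : 0 < s) (hp : 0 < ncChiPdf l s) :
    log (ncChiPdf l s) ≤ log 6 - (1 / 2) * log (8 * π * exp 1) := by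
  have hsq : ncChiPdf l s ^ 2 ≤ 9 / (2 * π * exp 1) := by
    rcases le_total l 1 with h | h
    · exact ncChiPdf_sq_le_of_le_one hl h
    · exact ncChiPdf_sq_le_of_one_le h hs
  have h := log_le_log (by positivity) hsq
  rw [show 9 / (2 * π * exp 1) = 6 ^ 2 / (8 * π * exp 1) by field_simp; norm_num,
    log_div (by positivity) (by positivity), log_pow, log_pow] at h
  push_cast at h
  linarith

theorem integral_Ioo_exp_mul_cos (x : ℝ) :
    ∫ θ in Set.Ioo (-π) π, exp (x * cos θ) = 2 * π * besselI0 x := by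
  have hint (a b : ℝ) : IntervalIntegrable (fun θ => exp (x * cos θ)) volume a b :=
    Continuous.intervalIntegrable (by fun_prop) _ _
  have hneg := integral_comp_neg (a := 0) (b := π) fun θ => exp (x * cos θ)
  simp only [cos_neg, neg_zero] at hneg
  rw [← integral_Ioc_eq_integral_Ioo, ← integral_of_le (by linarith [pi_pos]),
    ← integral_add_adjacent_intervals (hint (-π) 0) (hint 0 π), ← hneg, mul_assoc,
    pi_mul_besselI0, two_mul]

theorem integral_Ioo_polar_gaussian {l : ℝ} (hl : 0 ≤ l) (s : ℝ) :
    ∫ θ in Set.Ioo (-π) π,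
      s * (exp (-(1 / 2) * (s * cos θ - √l) ^ 2) * exp (-(1 / 2) * (s * sin θ) ^ 2)) =
      2 * π * ncChiPdf l s := by
  have h (θ : ℝ) :
      s * (exp (-(1 / 2) * (s * cos θ - √l) ^ 2) * exp (-(1 / 2) * (s * sin θ) ^ 2)) =
      s * exp (-(s ^ 2 + l) / 2) * exp (s * √l * cos θ) := by
    rw [← exp_add, mul_assoc, ← exp_add]
    congr 2
    nlinarith [sin_sq_add_cos_sq θ, sq_sqrt hl]
  simp_rw [h]
  rw [MeasureTheory.integral_const_mul, integral_Ioo_exp_mul_cos, ncChiPdf]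
  ring

theorem integrableOn_ncChiPdf_and_integral_eq_one {l : ℝ} (hl : 0 ≤ l) :
    IntegrableOn (ncChiPdf l) (Set.Ioi 0) ∧ ∫ s in Set.Ioi (0 : ℝ), ncChiPdf l s = 1 := by
  set f : ℝ × ℝ → ℝ := fun z => exp (-(1 / 2) * (z.1 - √l) ^ 2) * exp (-(1 / 2) * z.2 ^ 2)
    with hf
  have htotal : ∫ z, f z = 2 * π := by
    rw [hf, Measure.volume_eq_prod,
      integral_prod_mul (fun x => exp (-(1 / 2) * (x - √l) ^ 2)) fun y => exp (-(1 / 2) * y ^ 2),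
      integral_sub_right_eq_self (fun x => exp (-(1 / 2) * x ^ 2)) (√l), integral_gaussian,
      mul_self_sqrt (by positivity)]
    ring
  have hpolar := integral_comp_polarCoord_symm f
  rw [htotal] at hpolar
  have hint : IntegrableOn (fun p : ℝ × ℝ => p.1 • f (polarCoord.symm p))
      (Set.Ioi 0 ×ˢ Set.Ioo (-π) π) (volume.prod volume) := by
    by_contra h
    have h0 := integral_undef h
    have : (2 * π : ℝ) = 0 := hpolar.symm.trans h0
    linarith [pi_pos]
  have hiter := setIntegral_prod _ hint
  have hint' := hint
  rw [IntegrableOn, ← Measure.prod_restrict] at hint'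
  have hleft := hint'.integral_prod_left
  simp only [hf, polarCoord_symm_apply, smul_eq_mul, integral_Ioo_polar_gaussian hl]
    at hiter hleft
  have h2pi : (2 * π : ℝ) ≠ 0 := by positivity
  constructor
  · refine (hleft.const_mul (2 * π)⁻¹).congr (Filter.Eventually.of_forall fun s => ?_)
    field_simp
  · rw [MeasureTheory.integral_const_mul] at hiter
    have h := hiter.symm.trans hpolar
    exact mul_left_cancel₀ h2pi (h.trans (mul_one _).symm)

theorem abs_mul_log_le {x : ℝ} (hx : 0 ≤ x) (h1 : x ≤ 1) : |x * log x| ≤ 2 * √x := by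
  rcases hx.eq_or_lt with rfl | hx
  · simp
  have hs : 0 < √x := sqrt_pos.2 hx
  rw [abs_of_nonpos (mul_nonpos_of_nonneg_of_nonpos hx.le (log_nonpos hx.le h1))]
  have h := log_le_sub_one_of_pos (inv_pos.2 hs)
  rw [log_inv, log_sqrt hx.le] at h
  have hmul : x * (√x)⁻¹ = √x := by
    nth_rw 1 [← mul_self_sqrt hx.le]
    field_simp
  nlinarith

theorem ncChiPdf_le_exp {l s : ℝ} (hl : 0 ≤ l) (hs : 0 ≤ s) :
    ncChiPdf l s ≤ exp (2 * (-(1 / 4) * (s - (√l + 1)) ^ 2 + (√l / 2 + 1 / 4))) := by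
  calc ncChiPdf l s ≤ exp s * exp (-(s ^ 2 + l) / 2) * exp (s * √l) := by
        rw [ncChiPdf]
        gcongr
        · exact besselI0_nonneg _
        · linarith [add_one_le_exp s]
        · exact besselI0_le_exp (by positivity)
    _ = _ := by
        rw [← exp_add, ← exp_add]
        congr 1
        nlinarith [sq_sqrt hl]

theorem integrableOn_ncChiPdf_mul_log {l : ℝ} (hl : 0 ≤ l)
    (hle : ∀ s, 0 < s → ncChiPdf l s ≤ 1) :
    IntegrableOn (fun s => ncChiPdf l s * log (ncChiPdf l s)) (Set.Ioi 0) := by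
  have hg : Integrable fun s : ℝ =>
      2 * (exp (-(1 / 4) * (s - (√l + 1)) ^ 2) * exp (√l / 2 + 1 / 4)) :=
    (((integrable_exp_neg_mul_sq (by norm_num : (0 : ℝ) < 1 / 4)).comp_sub_right
      (√l + 1)).mul_const _).const_mul 2
  refine Integrable.mono' hg.integrableOn
    (continuous_mul_log.comp (continuous_ncChiPdf l)).aestronglyMeasurable ?_
  refine (ae_restrict_mem measurableSet_Ioi).mono fun s hs => ?_
  have hs : 0 < s := hs
  refine (abs_mul_log_le (ncChiPdf_nonneg l hs.le) (hle s hs)).trans ?_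
  gcongr
  rw [← exp_add, sqrt_le_left (exp_pos _).le, ← exp_nat_mul]
  exact_mod_cast ncChiPdf_le_exp hl hs.le

/-- Entropy lower bound (in nats) for the non-central chi distribution with two degrees
of freedom: `h(√T) ≥ (1/2) ln(8πe) − ln 6 + (1/2) Ei(−λ/2)`, where
`Ei(−λ/2) = −∫_{λ/2}^∞ e^{−t}/t dt`. -/
theorem ncChi_entropy_lower (l : ℝ) (hl : 0 < l) :
    (1 / 2) * Real.log (8 * π * Real.exp 1) - Real.log 6 -
        (1 / 2) * ∫ t in Set.Ioi (l / 2), Real.exp (-t) / t ≤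
      -∫ s in Set.Ioi (0:ℝ), ncChiPdf l s * Real.log (ncChiPdf l s) := by
  obtain ⟨hint, hone⟩ := integrableOn_ncChiPdf_and_integral_eq_one hl.le
  set c := log 6 - (1 / 2) * log (8 * π * exp 1) with hc
  have hc0 : c ≤ 0 := by
    have h : log (6 ^ 2) ≤ log (8 * π * exp 1) := by
      refine log_le_log (by norm_num) ?_
      nlinarith [pi_gt_three, add_one_le_exp (1 : ℝ)]
    rw [log_pow] at h
    push_cast at h
    linarith
  have hlog : ∀ s, 0 < s → 0 < ncChiPdf l s → log (ncChiPdf l s) ≤ c :=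
    fun s hs hp => log_ncChiPdf_le hl.le hs hp
  have hle : ∀ s, 0 < s → ncChiPdf l s ≤ 1 := fun s hs => by
    rcases (ncChiPdf_nonneg l hs.le).eq_or_lt with h | h
    · rw [← h]; exact zero_le_one
    · exact (log_nonpos_iff h.le).1 ((hlog s hs h).trans hc0)
  have hentropy : ∫ s in Set.Ioi (0 : ℝ), ncChiPdf l s * log (ncChiPdf l s) ≤ c := by
    calc ∫ s in Set.Ioi (0 : ℝ), ncChiPdf l s * log (ncChiPdf l s)
        ≤ ∫ s in Set.Ioi (0 : ℝ), ncChiPdf l s * c := by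
          refine setIntegral_mono_on (integrableOn_ncChiPdf_mul_log hl.le hle)
            (hint.mul_const c) measurableSet_Ioi fun s hs => ?_
          rcases (ncChiPdf_nonneg l (le_of_lt hs)).eq_or_lt with h | h
          · simp [← h]
          · exact mul_le_mul_of_nonneg_left (hlog s hs h) h.le
      _ = c := by rw [MeasureTheory.integral_mul_const, hone, one_mul]
  have hEi : 0 ≤ ∫ t in Set.Ioi (l / 2), exp (-t) / t :=
    setIntegral_nonneg measurableSet_Ioi fun t ht =>
      div_nonneg (exp_pos _).le ((half_pos hl).trans ht).le
  linarith
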